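/- Let X, Y, Z be finitely supported random variables taking values in an abelian group G, with Y and Z independent. Then d[X; Y − Z] − d[X; Y] ≤ (1/2)(H[Y − Z] − H[Y]) = (1/2)·d[Y; Z] + (1/4)·H[Z] − (1/4)·H[Y], and also d[X; Y | Y − Z] − d[X; Y] ≤ (1/2)(H[Y − Z] − H[Z]) = (1/2)·d[Y; Z] + (1/4)·H[Y] − (1/4)·H[Z]. -/

import Mathlib

open scoped Classical BigOperators Pointwise
open Finset

noncomputable section

/-- The probability that the random variable `X` equals `s`, under the pmf `μ`. -/
def pmass {Ω S : Type*} [Fintype Ω] (μ : Ω → ℝ) (X : Ω → S) (s : S) : ℝ :=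
  ∑ ω, if X ω = s then μ ω else 0

/-- `μ` is a probability mass function on the finite type `Ω`. -/
def IsProb {Ω : Type*} [Fintype Ω] (μ : Ω → ℝ) : Prop :=
  (∀ ω, 0 ≤ μ ω) ∧ ∑ ω, μ ω = 1

/-- Shannon entropy `H[X]` of a random variable `X : Ω → S` under `μ`. -/
def ent {Ω S : Type*} [Fintype Ω] (μ : Ω → ℝ) (X : Ω → S) : ℝ :=
  ∑ s ∈ Finset.univ.image X, Real.negMulLog (pmass μ X s)

/-- Mutual information `I[X : Y]`. -/
def mutualInfo {Ω S T : Type*} [Fintype Ω] (μ : Ω → ℝ) (X : Ω → S) (Y : Ω → T) : ℝ :=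
  ent μ X + ent μ Y - ent μ (fun ω => (X ω, Y ω))

/-- The conditional measure, conditioning on the event `Y = y`. -/
def condMeas {Ω T : Type*} [Fintype Ω] (μ : Ω → ℝ) (Y : Ω → T) (y : T) : Ω → ℝ :=
  fun ω => if Y ω = y then μ ω / pmass μ Y y else 0

/-- Conditional mutual information `I[X : Y | Z]`. -/
def condMutualInfo {Ω S T U : Type*} [Fintype Ω] (μ : Ω → ℝ)
    (X : Ω → S) (Y : Ω → T) (Z : Ω → U) : ℝ :=
  ∑ z ∈ Finset.univ.image Z, pmass μ Z z * mutualInfo (condMeas μ Z z) X Y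

/-- Entropic Ruzsa distance `d[X ; Y]`, defined via independent copies on a product space. -/
def rdist {Ω₁ Ω₂ G : Type*} [Fintype Ω₁] [Fintype Ω₂] [AddCommGroup G]
    (μ₁ : Ω₁ → ℝ) (X : Ω₁ → G) (μ₂ : Ω₂ → ℝ) (Y : Ω₂ → G) : ℝ :=
  ent (fun p : Ω₁ × Ω₂ => μ₁ p.1 * μ₂ p.2) (fun p => X p.1 - Y p.2)
    - ent μ₁ X / 2 - ent μ₂ Y / 2

/-- Conditional Ruzsa distance `d[X | Z ; Y | W]`. -/
def condRdist {Ω₁ Ω₂ G T U : Type*} [Fintype Ω₁] [Fintype Ω₂] [AddCommGroup G]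
    (μ₁ : Ω₁ → ℝ) (X : Ω₁ → G) (Z : Ω₁ → T)
    (μ₂ : Ω₂ → ℝ) (Y : Ω₂ → G) (W : Ω₂ → U) : ℝ :=
  ∑ z ∈ Finset.univ.image Z, ∑ w ∈ Finset.univ.image W,
    pmass μ₁ Z z * pmass μ₂ W w * rdist (condMeas μ₁ Z z) X (condMeas μ₂ W w) Y

/-- Conditional Ruzsa distance `d[X ; Y | W]`, conditioning only on the right variable. -/
def condRdistRight {Ω₁ Ω₂ G U : Type*} [Fintype Ω₁] [Fintype Ω₂] [AddCommGroup G]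
    (μ₁ : Ω₁ → ℝ) (X : Ω₁ → G)
    (μ₂ : Ω₂ → ℝ) (Y : Ω₂ → G) (W : Ω₂ → U) : ℝ :=
  ∑ w ∈ Finset.univ.image W, pmass μ₂ W w * rdist μ₁ X (condMeas μ₂ W w) Y

/-- The uniform probability mass function on a subset `H` of a finite type. -/
def unifOn {G : Type*} [Fintype G] (H : Set G) : G → ℝ :=
  fun g => if g ∈ H then ((Nat.card H : ℝ))⁻¹ else 0

/-- `X` (under `μ₁`) and `Y` (under `μ₂`) are identically distributed. -/
def IdentDist {Ω₁ Ω₂ S : Type*} [Fintype Ω₁] [Fintype Ω₂]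
    (μ₁ : Ω₁ → ℝ) (X : Ω₁ → S) (μ₂ : Ω₂ → ℝ) (Y : Ω₂ → S) : Prop :=
  ∀ s, pmass μ₁ X s = pmass μ₂ Y s

/-- Two random variables are independent. -/
def IndepPair {Ω S T : Type*} [Fintype Ω] (μ : Ω → ℝ) (X : Ω → S) (Y : Ω → T) : Prop :=
  ∀ s t, pmass μ (fun ω => (X ω, Y ω)) (s, t) = pmass μ X s * pmass μ Y t

/-- Three random variables are jointly independent. -/
def IndepTriple {Ω S T U : Type*} [Fintype Ω] (μ : Ω → ℝ)
    (X : Ω → S) (Y : Ω → T) (Z : Ω → U) : Prop :=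
  ∀ s t u, pmass μ (fun ω => (X ω, Y ω, Z ω)) (s, t, u)
    = pmass μ X s * pmass μ Y t * pmass μ Z u

/-- Four random variables are jointly independent. -/
def IndepFour {Ω S T U V : Type*} [Fintype Ω] (μ : Ω → ℝ)
    (X : Ω → S) (Y : Ω → T) (Z : Ω → U) (W : Ω → V) : Prop :=
  ∀ s t u v, pmass μ (fun ω => (X ω, Y ω, Z ω, W ω)) (s, t, u, v)
    = pmass μ X s * pmass μ Y t * pmass μ Z u * pmass μ W v


lemma kv_fiber {Ω S : Type*} [Fintype Ω] (μ : Ω → ℝ) (X : Ω → S) (T : Finset S)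
    (hT : ∀ ω, X ω ∈ T) (g : S → ℝ) :
    ∑ ω, μ ω * g (X ω) = ∑ s ∈ T, pmass μ X s * g s := by
  simp only [pmass, Finset.sum_mul]
  rw [Finset.sum_comm]
  refine Finset.sum_congr rfl fun ω _ => ?_
  simp only [ite_mul, zero_mul]
  rw [Finset.sum_ite_eq]
  simp [hT ω]

lemma kv_ent_eq {Ω S : Type*} [Fintype Ω] (μ : Ω → ℝ) (X : Ω → S) :
    ent μ X = ∑ ω, μ ω * (- Real.log (pmass μ X (X ω))) := by
  rw [kv_fiber μ X (Finset.univ.image X) (fun ω => Finset.mem_image_of_mem _ (Finset.mem_univ _))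
    (fun s => - Real.log (pmass μ X s))]
  unfold ent
  refine Finset.sum_congr rfl fun s _ => ?_
  simp [Real.negMulLog]

lemma kv_pmass_nonneg {Ω S : Type*} [Fintype Ω] {μ : Ω → ℝ} (h : ∀ ω, 0 ≤ μ ω) (X : Ω → S)
    (s : S) : 0 ≤ pmass μ X s :=
  Finset.sum_nonneg fun ω _ => by split_ifs <;> simp [h ω]

lemma kv_le_pmass {Ω S : Type*} [Fintype Ω] {μ : Ω → ℝ} (h : ∀ ω, 0 ≤ μ ω) (X : Ω → S)
    (ω : Ω) : μ ω ≤ pmass μ X (X ω) := by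
  have := Finset.single_le_sum (f := fun ω' => if X ω' = X ω then μ ω' else 0)
    (fun ω' _ => by split_ifs <;> simp [h ω']) (Finset.mem_univ ω)
  simpa [pmass] using this

lemma kv_relabel {Ω S T : Type*} [Fintype Ω] (μ : Ω → ℝ) (X : Ω → S) (Y : Ω → T)
    (h : ∀ ω ω', X ω = X ω' ↔ Y ω = Y ω') : ent μ X = ent μ Y := by
  rw [kv_ent_eq, kv_ent_eq]
  refine Finset.sum_congr rfl fun ω _ => ?_
  have : pmass μ X (X ω) = pmass μ Y (Y ω) := by
    unfold pmass
    refine Finset.sum_congr rfl fun ω' _ => ?_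
    simp only [h]
  rw [this]

lemma kv_pmass_map {Ω S T : Type*} [Fintype Ω] (μ : Ω → ℝ) (V : Ω → S) (f : S → T)
    (A : Finset S) (hA : ∀ ω, V ω ∈ A) (t : T) :
    pmass μ (fun ω => f (V ω)) t = ∑ v ∈ A, pmass μ V v * (if f v = t then 1 else 0) := by
  rw [← kv_fiber μ V A hA (fun v => if f v = t then 1 else 0)]
  simp [pmass]

lemma kv_pmass_zero {Ω S : Type*} [Fintype Ω] (μ : Ω → ℝ) (X : Ω → S) (s : S)
    (h : ∀ ω, X ω ≠ s) : pmass μ X s = 0 := by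
  simp [pmass, h]

lemma kv_ent_superset {Ω S : Type*} [Fintype Ω] (μ : Ω → ℝ) (X : Ω → S) (A : Finset S)
    (hA : ∀ ω, X ω ∈ A) : ent μ X = ∑ s ∈ A, Real.negMulLog (pmass μ X s) := by
  unfold ent
  apply Finset.sum_subset
  · intro s hs
    obtain ⟨ω, _, rfl⟩ := Finset.mem_image.1 hs
    exact hA ω
  · intro s _ hs
    rw [kv_pmass_zero]
    · simp
    · intro ω h
      exact hs (h ▸ Finset.mem_image_of_mem _ (Finset.mem_univ _))

lemma kv_ident {Ω Ω' S T : Type*} [Fintype Ω] [Fintype Ω'] (μ : Ω → ℝ) (μ' : Ω' → ℝ)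
    (V : Ω → S) (V' : Ω' → S) (h : ∀ s, pmass μ V s = pmass μ' V' s) (f : S → T) :
    ent μ (fun ω => f (V ω)) = ent μ' (fun ω => f (V' ω)) := by
  set A := Finset.univ.image V ∪ Finset.univ.image V' with hAd
  have h1 : ∀ ω, V ω ∈ A := fun ω => Finset.mem_union_left _
    (Finset.mem_image_of_mem _ (Finset.mem_univ _))
  have h2 : ∀ ω, V' ω ∈ A := fun ω => Finset.mem_union_right _
    (Finset.mem_image_of_mem _ (Finset.mem_univ _))
  rw [kv_ent_superset μ _ (A.image f) (fun ω => Finset.mem_image_of_mem _ (h1 ω)),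
    kv_ent_superset μ' _ (A.image f) (fun ω => Finset.mem_image_of_mem _ (h2 ω))]
  refine Finset.sum_congr rfl fun t _ => ?_
  rw [kv_pmass_map μ V f A h1, kv_pmass_map μ' V' f A h2]
  simp only [h]

lemma kv_marg {Ω S T : Type*} [Fintype Ω] (μ : Ω → ℝ) (A : Ω → S) (B : Ω → T) (t : T) :
    ∑ s ∈ Finset.univ.image A, pmass μ (fun ω => (A ω, B ω)) (s, t) = pmass μ B t := by
  unfold pmass
  rw [Finset.sum_comm]
  refine Finset.sum_congr rfl fun ω _ => ?_
  by_cases h : B ω = t <;> simp [h]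

lemma kv_marg' {Ω S T : Type*} [Fintype Ω] (μ : Ω → ℝ) (A : Ω → S) (B : Ω → T) (s : S) :
    ∑ t ∈ Finset.univ.image B, pmass μ (fun ω => (A ω, B ω)) (s, t) = pmass μ A s := by
  unfold pmass
  rw [Finset.sum_comm]
  refine Finset.sum_congr rfl fun ω _ => ?_
  by_cases h : A ω = s <;> simp [h]

lemma kv_sum_pmass {Ω S : Type*} [Fintype Ω] {μ : Ω → ℝ} (hμ : IsProb μ) (X : Ω → S) :
    ∑ s ∈ Finset.univ.image X, pmass μ X s = 1 := by
  have := kv_fiber μ X (Finset.univ.image X)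
    (fun ω => Finset.mem_image_of_mem _ (Finset.mem_univ _)) (fun _ => 1)
  simp only [mul_one] at this
  rw [← this, hμ.2]

lemma kv_submod {Ω R S T : Type*} [Fintype Ω] {μ : Ω → ℝ} (hμ : IsProb μ)
    (A : Ω → R) (S' : Ω → S) (C : Ω → T) :
    ent μ (fun ω => (A ω, S' ω, C ω)) + ent μ S'
      ≤ ent μ (fun ω => (A ω, S' ω)) + ent μ (fun ω => (S' ω, C ω)) := by
  set p3 := pmass μ (fun ω => (A ω, S' ω, C ω)) with hp3
  set p1 := pmass μ (fun ω => (A ω, S' ω)) with hp1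
  set p2 := pmass μ (fun ω => (S' ω, C ω)) with hp2
  set p0 := pmass μ S' with hp0
  have n3 : ∀ x, 0 ≤ p3 x := kv_pmass_nonneg hμ.1 _
  have n1 : ∀ x, 0 ≤ p1 x := kv_pmass_nonneg hμ.1 _
  have n2 : ∀ x, 0 ≤ p2 x := kv_pmass_nonneg hμ.1 _
  have n0 : ∀ x, 0 ≤ p0 x := kv_pmass_nonneg hμ.1 _
  let r : R × S × T → ℝ := fun x => p1 (x.1, x.2.1) * p2 x.2 / (p3 x * p0 x.2.1)
  have key : ∀ ω, μ ω * (-Real.log (p3 (A ω, S' ω, C ω))) + μ ω * (-Real.log (p0 (S' ω)))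
      - μ ω * (-Real.log (p1 (A ω, S' ω))) - μ ω * (-Real.log (p2 (S' ω, C ω)))
      ≤ μ ω * r (A ω, S' ω, C ω) - μ ω := by
    intro ω
    rcases (hμ.1 ω).eq_or_lt with h | h
    · simp [← h]
    · have q3 : 0 < p3 (A ω, S' ω, C ω) :=
        h.trans_le (kv_le_pmass hμ.1 (fun ω => (A ω, S' ω, C ω)) ω)
      have q1 : 0 < p1 (A ω, S' ω) := h.trans_le (kv_le_pmass hμ.1 (fun ω => (A ω, S' ω)) ω)
      have q2 : 0 < p2 (S' ω, C ω) := h.trans_le (kv_le_pmass hμ.1 (fun ω => (S' ω, C ω)) ω)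
      have q0 : 0 < p0 (S' ω) := h.trans_le (kv_le_pmass hμ.1 S' ω)
      have hl : Real.log (r (A ω, S' ω, C ω)) ≤ r (A ω, S' ω, C ω) - 1 :=
        Real.log_le_sub_one_of_pos (by simp only [r]; positivity)
      have he : Real.log (r (A ω, S' ω, C ω)) = Real.log (p1 (A ω, S' ω))
          + Real.log (p2 (S' ω, C ω)) - (Real.log (p3 (A ω, S' ω, C ω)) + Real.log (p0 (S' ω))) := by
        simp only [r]
        rw [Real.log_div (by positivity) (by positivity), Real.log_mul q1.ne' q2.ne',
          Real.log_mul q3.ne' q0.ne']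
      nlinarith [mul_le_mul_of_nonneg_left hl h.le]
  have hsum := Finset.sum_le_sum (fun ω (_ : ω ∈ Finset.univ) => key ω)
  simp only [Finset.sum_sub_distrib, Finset.sum_add_distrib] at hsum
  rw [hμ.2] at hsum
  have e3 := kv_ent_eq μ (fun ω => (A ω, S' ω, C ω))
  have e1 := kv_ent_eq μ (fun ω => (A ω, S' ω))
  have e2 := kv_ent_eq μ (fun ω => (S' ω, C ω))
  have e0 := kv_ent_eq μ S'
  have hr : ∑ ω, μ ω * r (A ω, S' ω, C ω) ≤ 1 := by
    rw [kv_fiber μ (fun ω => (A ω, S' ω, C ω))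
      (Finset.univ.image A ×ˢ (Finset.univ.image S' ×ˢ Finset.univ.image C)) (by simp) r]
    calc _ ≤ ∑ x ∈ Finset.univ.image A ×ˢ (Finset.univ.image S' ×ˢ Finset.univ.image C),
          p1 (x.1, x.2.1) * p2 x.2 / p0 x.2.1 := by
          refine Finset.sum_le_sum fun x _ => ?_
          change p3 x * (p1 (x.1, x.2.1) * p2 x.2 / (p3 x * p0 x.2.1)) ≤ _
          rcases (n3 x).eq_or_lt with h | h
          · rw [← h, zero_mul]
            exact div_nonneg (mul_nonneg (n1 _) (n2 _)) (n0 _)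
          · apply le_of_eq
            rw [mul_div_assoc', mul_div_mul_left _ _ h.ne']
      _ = ∑ s ∈ Finset.univ.image S', p0 s := by
          rw [Finset.sum_product, Finset.sum_comm' (t' := Finset.univ.image S' ×ˢ Finset.univ.image C)
            (s' := fun _ => Finset.univ.image A) (by simp [and_comm]), Finset.sum_product]
          refine Finset.sum_congr rfl fun s _ => ?_
          simp only [← Finset.sum_div, ← Finset.sum_mul, ← Finset.mul_sum]
          rw [hp1, hp2, kv_marg, kv_marg', ← hp0]
          rcases (n0 s).eq_or_lt with h | h
          · simp [← h]
          · field_simp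
      _ = 1 := kv_sum_pmass hμ S'
  linarith

lemma kv_subadd {Ω R T : Type*} [Fintype Ω] {μ : Ω → ℝ} (hμ : IsProb μ)
    (A : Ω → R) (C : Ω → T) :
    ent μ (fun ω => (A ω, C ω)) ≤ ent μ A + ent μ C := by
  have h := kv_submod hμ A (fun _ => ()) C
  have h0 : ent μ (fun _ : Ω => ()) = 0 := by
    rw [kv_ent_eq]; simp [pmass, hμ.2]
  rw [h0, kv_relabel μ (fun ω => (A ω, (), C ω)) (fun ω => (A ω, C ω)) (by simp),
    kv_relabel μ (fun ω => (A ω, ())) A (by simp),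
    kv_relabel μ (fun ω => ((), C ω)) C (by simp)] at h
  linarith

lemma kv_indep {Ω R T : Type*} [Fintype Ω] {μ : Ω → ℝ} (hμ : IsProb μ)
    (A : Ω → R) (C : Ω → T) (h : IndepPair μ A C) :
    ent μ (fun ω => (A ω, C ω)) = ent μ A + ent μ C := by
  rw [kv_ent_eq, kv_ent_eq, kv_ent_eq, ← Finset.sum_add_distrib]
  refine Finset.sum_congr rfl fun ω _ => ?_
  rcases (hμ.1 ω).eq_or_lt with h0 | h0
  · simp [← h0]
  · rw [h, Real.log_mul (h0.trans_le (kv_le_pmass hμ.1 A ω)).ne'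
      (h0.trans_le (kv_le_pmass hμ.1 C ω)).ne']
    ring

lemma kv_prod_prob {Ω₁ Ω₂ : Type*} [Fintype Ω₁] [Fintype Ω₂] {μ₁ : Ω₁ → ℝ} {μ₂ : Ω₂ → ℝ}
    (h₁ : IsProb μ₁) (h₂ : IsProb μ₂) : IsProb (fun p : Ω₁ × Ω₂ => μ₁ p.1 * μ₂ p.2) := by
  refine ⟨fun p => mul_nonneg (h₁.1 _) (h₂.1 _), ?_⟩
  rw [Fintype.sum_prod_type]
  simp only [← Finset.mul_sum, h₂.2, mul_one, h₁.2]

lemma kv_prod_pmass {Ω₁ Ω₂ S T : Type*} [Fintype Ω₁] [Fintype Ω₂] (μ₁ : Ω₁ → ℝ) (μ₂ : Ω₂ → ℝ)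
    (X : Ω₁ → S) (V : Ω₂ → T) (s : S) (t : T) :
    pmass (fun p : Ω₁ × Ω₂ => μ₁ p.1 * μ₂ p.2) (fun p => (X p.1, V p.2)) (s, t)
      = pmass μ₁ X s * pmass μ₂ V t := by
  unfold pmass
  rw [Fintype.sum_prod_type, Finset.sum_mul_sum]
  refine Finset.sum_congr rfl fun a _ => Finset.sum_congr rfl fun b _ => ?_
  by_cases h : X a = s <;> by_cases h' : V b = t <;> simp [h, h']

lemma kv_fst_pmass {Ω₁ Ω₂ S : Type*} [Fintype Ω₁] [Fintype Ω₂] (μ₁ : Ω₁ → ℝ) {μ₂ : Ω₂ → ℝ}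
    (h₂ : IsProb μ₂) (X : Ω₁ → S) (s : S) :
    pmass (fun p : Ω₁ × Ω₂ => μ₁ p.1 * μ₂ p.2) (fun p => X p.1) s = pmass μ₁ X s := by
  unfold pmass
  rw [Fintype.sum_prod_type]
  refine Finset.sum_congr rfl fun a _ => ?_
  by_cases h : X a = s <;> simp [h, ← Finset.mul_sum, h₂.2]

lemma kv_snd_pmass {Ω₁ Ω₂ S : Type*} [Fintype Ω₁] [Fintype Ω₂] {μ₁ : Ω₁ → ℝ} (μ₂ : Ω₂ → ℝ)
    (h₁ : IsProb μ₁) (X : Ω₂ → S) (s : S) :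
    pmass (fun p : Ω₁ × Ω₂ => μ₁ p.1 * μ₂ p.2) (fun p => X p.2) s = pmass μ₂ X s := by
  unfold pmass
  rw [Fintype.sum_prod_type_right]
  refine Finset.sum_congr rfl fun a _ => ?_
  by_cases h : X a = s <;> simp [h, ← Finset.sum_mul, h₁.2]

lemma kv_chain {Ω S U : Type*} [Fintype Ω] {μ : Ω → ℝ} (hμ : ∀ ω, 0 ≤ μ ω) (X : Ω → S)
    (W : Ω → U) (A : Finset U) (hA : ∀ ω, W ω ∈ A) :
    ∑ w ∈ A, pmass μ W w * ent (condMeas μ W w) X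
      = ent μ (fun ω => (X ω, W ω)) - ent μ W := by
  have hc : ∀ w x, pmass (condMeas μ W w) X x
      = pmass μ (fun ω => (X ω, W ω)) (x, w) / pmass μ W w := by
    intro w x
    unfold pmass condMeas
    rw [Finset.sum_div]
    refine Finset.sum_congr rfl fun ω _ => ?_
    by_cases h : X ω = x <;> by_cases h' : W ω = w <;> simp [h, h', pmass]
  rw [kv_ent_eq μ, kv_ent_eq μ, ← Finset.sum_sub_distrib]
  have : ∀ w ∈ A, pmass μ W w * ent (condMeas μ W w) X = ∑ ω, if W ω = w then
      (μ ω * (-Real.log (pmass μ (fun ω => (X ω, W ω)) (X ω, W ω)))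
        - μ ω * (-Real.log (pmass μ W (W ω)))) else 0 := by
    intro w _
    rw [kv_ent_eq, Finset.mul_sum]
    refine Finset.sum_congr rfl fun ω _ => ?_
    rw [hc]
    unfold condMeas
    split_ifs with h
    · subst h
      rcases (hμ ω).eq_or_lt with h0 | h0
      · simp [← h0]
      · have q0 := h0.trans_le (kv_le_pmass hμ W ω)
        have q1 := h0.trans_le (kv_le_pmass hμ (fun ω => (X ω, W ω)) ω)
        rw [Real.log_div q1.ne' q0.ne']
        field_simp
        ring
    · simp
  rw [Finset.sum_congr rfl this, Finset.sum_comm]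
  refine Finset.sum_congr rfl fun ω _ => ?_
  rw [Finset.sum_ite_eq]
  simp [hA ω]

/-- **Lemma 5.2.** For `X, Y, Z` group-valued with `Y, Z` independent:
`d[X; Y - Z] - d[X; Y] ≤ (H[Y - Z] - H[Y])/2 = d[Y; Z]/2 + H[Z]/4 - H[Y]/4`, and
`d[X; Y | Y - Z] - d[X; Y] ≤ (H[Y - Z] - H[Z])/2 = d[Y; Z]/2 + H[Y]/4 - H[Z]/4`. -/
theorem kv_estimates {G Ω₁ Ω₂ : Type*} [AddCommGroup G] [Fintype Ω₁] [Fintype Ω₂]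
    (μ₁ : Ω₁ → ℝ) (μ₂ : Ω₂ → ℝ) (hμ₁ : IsProb μ₁) (hμ₂ : IsProb μ₂)
    (X : Ω₁ → G) (Y Z : Ω₂ → G) (hindep : IndepPair μ₂ Y Z) :
    (rdist μ₁ X μ₂ (fun ω => Y ω - Z ω) - rdist μ₁ X μ₂ Y
        ≤ (1/2) * (ent μ₂ (fun ω => Y ω - Z ω) - ent μ₂ Y)
      ∧ (1/2) * (ent μ₂ (fun ω => Y ω - Z ω) - ent μ₂ Y)
        = (1/2) * rdist μ₂ Y μ₂ Z + (1/4) * ent μ₂ Z - (1/4) * ent μ₂ Y)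
    ∧ (condRdistRight μ₁ X μ₂ Y (fun ω => Y ω - Z ω) - rdist μ₁ X μ₂ Y
        ≤ (1/2) * (ent μ₂ (fun ω => Y ω - Z ω) - ent μ₂ Z)
      ∧ (1/2) * (ent μ₂ (fun ω => Y ω - Z ω) - ent μ₂ Z)
        = (1/2) * rdist μ₂ Y μ₂ Z + (1/4) * ent μ₂ Y - (1/4) * ent μ₂ Z) := by
  have hP := kv_prod_prob hμ₁ hμ₂
  set P : Ω₁ × Ω₂ → ℝ := fun p => μ₁ p.1 * μ₂ p.2 with hPd
  have hYZ : ent μ₂ (fun ω => (Y ω, Z ω)) = ent μ₂ Y + ent μ₂ Z := kv_indep hμ₂ Y Z hindep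
  have hd : ent (fun p : Ω₂ × Ω₂ => μ₂ p.1 * μ₂ p.2) (fun p => Y p.1 - Z p.2)
      = ent μ₂ (fun ω => Y ω - Z ω) :=
    kv_ident _ μ₂ (fun p : Ω₂ × Ω₂ => (Y p.1, Z p.2)) (fun ω => (Y ω, Z ω))
      (fun s => by rw [kv_prod_pmass, ← hindep]) (fun x => x.1 - x.2)
  have hX : ent P (fun p => X p.1) = ent μ₁ X :=
    kv_ident P μ₁ (fun p => X p.1) X (kv_fst_pmass μ₁ hμ₂ X) id
  have hsnd : ∀ {S : Type _} (V : Ω₂ → S), ent P (fun p => V p.2) = ent μ₂ V := fun V =>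
    kv_ident P μ₂ (fun p => V p.2) V (kv_snd_pmass μ₂ hμ₁ V) id
  refine ⟨⟨?_, ?_⟩, ?_, ?_⟩
  · have h3 : ent P (fun p => (X p.1, (Y p.2, Z p.2)))
        = ent P (fun p => X p.1) + ent P (fun p => (Y p.2, Z p.2)) := by
      apply kv_indep hP
      intro s t
      rw [kv_fst_pmass μ₁ hμ₂ X, kv_snd_pmass μ₂ hμ₁ (fun ω => (Y ω, Z ω))]
      exact kv_prod_pmass μ₁ μ₂ X (fun ω => (Y ω, Z ω)) s t
    have h3' : ent P (fun p => (Y p.2, Z p.2)) = ent μ₂ (fun ω => (Y ω, Z ω)) :=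
      kv_ident P μ₂ (fun p => (Y p.2, Z p.2)) (fun ω => (Y ω, Z ω))
        (kv_snd_pmass μ₂ hμ₁ (fun ω => (Y ω, Z ω))) id
    have hs := kv_submod hP (fun p => X p.1) (fun p => X p.1 - (Y p.2 - Z p.2)) (fun p => Z p.2)
    rw [kv_relabel P (fun p => (X p.1, X p.1 - (Y p.2 - Z p.2), Z p.2))
        (fun p => (X p.1, (Y p.2, Z p.2))) (by
          intro a b
          simp only [Prod.mk.injEq]
          constructor
          · rintro ⟨h1, h2, h3⟩
            rw [h1, h3] at h2
            refine ⟨h1, ?_, h3⟩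
            simpa using h2
          · rintro ⟨h1, h2, h3⟩
            simp [h1, h2, h3]),
      kv_relabel P (fun p => (X p.1, X p.1 - (Y p.2 - Z p.2)))
        (fun p => (X p.1, Y p.2 - Z p.2)) (by
          intro a b
          simp only [Prod.mk.injEq]
          constructor
          · rintro ⟨h1, h2⟩
            rw [h1] at h2
            exact ⟨h1, by simpa using h2⟩
          · rintro ⟨h1, h2⟩
            simp [h1, h2]),
      kv_relabel P (fun p => (X p.1 - (Y p.2 - Z p.2), Z p.2))
        (fun p => (X p.1 - Y p.2, Z p.2)) (by
          intro a b
          simp only [Prod.mk.injEq]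
          constructor
          · rintro ⟨h1, h2⟩
            rw [h2, ← sub_add, ← sub_add] at h1
            exact ⟨add_right_cancel h1, h2⟩
          · rintro ⟨h1, h2⟩
            rw [← sub_add, ← sub_add, h1, h2]
            exact ⟨rfl, rfl⟩)] at hs
    have a1 := kv_subadd hP (fun p => X p.1) (fun p => Y p.2 - Z p.2)
    have a2 := kv_subadd hP (fun p => X p.1 - Y p.2) (fun p => Z p.2)
    have b1 := hsnd (fun ω => Y ω - Z ω)
    have b2 := hsnd Z
    unfold rdist
    linarith
  · unfold rdist
    rw [hd]; ring
  · set W : Ω₂ → G := fun ω => Y ω - Z ω with hW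
    have hmem : ∀ ω, W ω ∈ Finset.univ.image W :=
      fun ω => Finset.mem_image_of_mem _ (Finset.mem_univ _)
    have c1 := kv_chain hμ₂.1 Y W (Finset.univ.image W) hmem
    have c2 := kv_chain hP.1 (fun p => X p.1 - Y p.2) (fun p => W p.2) (Finset.univ.image W)
      (fun p => hmem p.2)
    have hcm : ∀ w, condMeas P (fun p => W p.2) w
        = fun p : Ω₁ × Ω₂ => μ₁ p.1 * condMeas μ₂ W w p.2 := by
      intro w
      funext p
      unfold condMeas
      rw [kv_snd_pmass μ₂ hμ₁ W w]
      split_ifs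
      · rw [hPd]; ring
      · simp
    simp only [hcm] at c2
    have hpm : ∀ w, pmass P (fun p => W p.2) w = pmass μ₂ W w := kv_snd_pmass μ₂ hμ₁ W
    simp only [hpm] at c2
    have hsum := kv_sum_pmass hμ₂ W
    have hcr : condRdistRight μ₁ X μ₂ Y W
        = (∑ w ∈ Finset.univ.image W, pmass μ₂ W w *
            ent (fun p : Ω₁ × Ω₂ => μ₁ p.1 * condMeas μ₂ W w p.2) (fun p => X p.1 - Y p.2))
          - ent μ₁ X / 2
          - (∑ w ∈ Finset.univ.image W, pmass μ₂ W w * ent (condMeas μ₂ W w) Y) / 2 := by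
      have : ent μ₁ X / 2 = ∑ w ∈ Finset.univ.image W, pmass μ₂ W w * (ent μ₁ X / 2) := by
        rw [← Finset.sum_mul, hsum, one_mul]
      rw [this, Finset.sum_div, ← Finset.sum_sub_distrib, ← Finset.sum_sub_distrib]
      unfold condRdistRight rdist
      refine Finset.sum_congr rfl fun w _ => ?_
      ring
    have hYW : ent μ₂ (fun ω => (Y ω, W ω)) = ent μ₂ (fun ω => (Y ω, Z ω)) := by
      apply kv_relabel
      intro a b
      simp only [Prod.mk.injEq, hW]
      constructor
      · rintro ⟨h1, h2⟩
        rw [h1] at h2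
        exact ⟨h1, by simpa using h2⟩
      · rintro ⟨h1, h2⟩
        simp [h1, h2]
    have a1 := kv_subadd hP (fun p => X p.1 - Y p.2) (fun p => W p.2)
    rw [hcr, c1, c2, hYW, hYZ]
    unfold rdist
    linarith
  · unfold rdist
    rw [hd]; ring

end
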